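/- A normalised cochain β + γ ∈ Hom(V⊗S,S) ⊕ Hom(⊙²S, so(V)) satisfies the first cocycle condition γ(s,s)v + 2[s, β_v s] = 0 (for all s ∈ S, v ∈ V) if and only if it has the form (β_μ s)^A = C_μ{}^A{}_B s^B + ½ H_{μρσ} Γ^{ρσ} s^A + φ^{ρ A}{}_B Γ_{μρ} s^B and γ(s,s)_{μν} = 2 κ^ρ H_{ρμν} − 2 φ^ρ{}_{AB} ω_{μνρ}{}^{AB}, for some C ∈ V ⊗ ⊙²Δ, H ∈ Λ³V and φ ∈ V ⊗ ⊙²Δ, where κ and ω are the Dirac current and 3-form bilinears of s. -/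

import Mathlib

/-!
Algebraic set-up for six-dimensional (1,0) spinor calculus.

`(V, η)` is the six-dimensional mostly-plus lorentzian vector space, realised as
`Fin 6 → ℝ` with metric `ηd = diag(-1,1,1,1,1,1)`.  The (complexified) Clifford
module `Σ` is realised as `Spinor8 = Fin 8 → ℂ`; the structure `CliffordData`
packages gamma matrices satisfying the Clifford relation `v·v = η(v,v)𝟙`, the
symmetric spinor inner product `⟨-,-⟩` (given by the matrix `B`, symmetric,
nondegenerate, with `⟨v·s,t⟩ = -⟨s,v·t⟩`, and for which the chiral summands are
isotropic), and the quaternionic structure `J`.  `Δ` is the fundamental `Sp(1)`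
module `Fin 2 → ℂ` with symplectic form `epsS` (`ε₁₂ = 1`), and an element of
the real representation `S` with `S ⊗ ℂ = Σ₊ ⊗ Δ` is a pair `s : Fin 2 → Spinor8`
of positive-chirality spinors satisfying the reality condition `IsS`.
-/

noncomputable section

open Matrix BigOperators

/-- Spinors of the 8-dimensional complex Clifford module Σ. -/
abbrev Spinor8 := Fin 8 → ℂ

/-- Mostly-plus Minkowski metric `diag(-1,1,1,1,1,1)`. -/
def ηd (μ : Fin 6) : ℝ := if μ = 0 then -1 else 1

/-- The symplectic form ε on Δ, with `ε₁₂ = 1`. -/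
def epsS (A B : Fin 2) : ℂ := if A = 0 ∧ B = 1 then 1 else if A = 1 ∧ B = 0 then -1 else 0

/-- The Levi-Civita symbol on six indices. -/
def eps6 (μ ν ρ σ τ υ : Fin 6) : ℝ :=
  (Matrix.of (fun i j => if (![μ, ν, ρ, σ, τ, υ] i) = j then (1 : ℝ) else 0) :
    Matrix (Fin 6) (Fin 6) ℝ).det

/-- Data of the irreducible Clifford module Σ of `Cℓ(V)`, `V = ℝ^{5,1}`:
gamma matrices, the symmetric spinor pairing `B` and the quaternionic
structure `J`. -/
structure CliffordData where
  /-- gamma matrices `Γ_μ` -/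
  Γ : Fin 6 → Matrix (Fin 8) (Fin 8) ℂ
  /-- the Clifford relation `Γ_μ Γ_ν + Γ_ν Γ_μ = 2 η_{μν} 𝟙` -/
  clifford : ∀ μ ν, Γ μ * Γ ν + Γ ν * Γ μ =
    (if μ = ν then 2 * (ηd μ : ℂ) else 0) • (1 : Matrix (Fin 8) (Fin 8) ℂ)
  /-- matrix of the symmetric inner product `⟨-,-⟩`, `⟨s,t⟩ = sᵀ B t` -/
  B : Matrix (Fin 8) (Fin 8) ℂ
  B_symm : B.transpose = B
  B_nondeg : IsUnit B
  /-- `⟨v·s, t⟩ = -⟨s, v·t⟩` -/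
  B_skew : ∀ μ, (Γ μ).transpose * B = - (B * Γ μ)
  /-- the chiral summands `Σ±` are isotropic for `⟨-,-⟩`:
      `⟨P₊s, P₊t⟩ = 0 = ⟨P₋s, P₋t⟩`, where `P± = ½(1 ± Γ₇)` -/
  B_iso_pos : ((1 : Matrix (Fin 8) (Fin 8) ℂ) + Γ 0 * Γ 1 * Γ 2 * Γ 3 * Γ 4 * Γ 5).transpose *
      B * (1 + Γ 0 * Γ 1 * Γ 2 * Γ 3 * Γ 4 * Γ 5) = 0
  B_iso_neg : ((1 : Matrix (Fin 8) (Fin 8) ℂ) - Γ 0 * Γ 1 * Γ 2 * Γ 3 * Γ 4 * Γ 5).transpose *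
      B * (1 - Γ 0 * Γ 1 * Γ 2 * Γ 3 * Γ 4 * Γ 5) = 0
  /-- quaternionic structure on Σ: the conjugate-linear map `s ↦ J (star s)` -/
  J : Matrix (Fin 8) (Fin 8) ℂ
  J_conj : ∀ μ, J * (Γ μ).map (starRingEnd ℂ) = Γ μ * J
  J_sq : J * J.map (starRingEnd ℂ) = -1

namespace CliffordData

variable (d : CliffordData)

/-- the Clifford volume element `Γ₇ = Γ₀Γ₁Γ₂Γ₃Γ₄Γ₅` -/
def Γ7 : Matrix (Fin 8) (Fin 8) ℂ := d.Γ 0 * d.Γ 1 * d.Γ 2 * d.Γ 3 * d.Γ 4 * d.Γ 5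

/-- gamma matrix with raised index, `Γ^μ = η^{μμ} Γ_μ` -/
def ΓU (μ : Fin 6) : Matrix (Fin 8) (Fin 8) ℂ := (ηd μ : ℂ) • d.Γ μ

/-- the pairing `s̄ t = ⟨s, t⟩` -/
def pair (s t : Spinor8) : ℂ := s ⬝ᵥ d.B.mulVec t

/-- positive chirality: `Γ₇ s = s`, i.e. `s ∈ Σ₊` -/
def Pos (s : Spinor8) : Prop := d.Γ7.mulVec s = s

/-- the quaternionic conjugation on Σ -/
def conjS (s : Spinor8) : Spinor8 := d.J.mulVec fun a => (starRingEnd ℂ) (s a)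

/-- membership in (the complexification of) the real form `S ⊂ Σ₊ ⊗ Δ`:
positive chirality together with the reality condition w.r.t. the
quaternionic structure `J ⊗ J_Δ` (`J_Δ` the standard one on `Δ`). -/
def IsS (s : Fin 2 → Spinor8) : Prop :=
  (∀ A, d.Pos (s A)) ∧ d.conjS (s 0) = s 1 ∧ d.conjS (s 1) = - s 0

/-- antisymmetrised product `Γ_{μν}` -/
def Γ2 (μ ν : Fin 6) : Matrix (Fin 8) (Fin 8) ℂ :=
  (1 / 2 : ℂ) • (d.Γ μ * d.Γ ν - d.Γ ν * d.Γ μ)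

/-- antisymmetrised product `Γ_{μνρ}` -/
def Γ3 (μ ν ρ : Fin 6) : Matrix (Fin 8) (Fin 8) ℂ :=
  (1 / 6 : ℂ) • (d.Γ μ * d.Γ ν * d.Γ ρ - d.Γ μ * d.Γ ρ * d.Γ ν
    + d.Γ ν * d.Γ ρ * d.Γ μ - d.Γ ν * d.Γ μ * d.Γ ρ
    + d.Γ ρ * d.Γ μ * d.Γ ν - d.Γ ρ * d.Γ ν * d.Γ μ)

/-- the family of 3-forms `ω_{μνρ}{}^{AB} = s̄^A Γ_{μνρ} s^B` -/
def omega3 (s : Fin 2 → Spinor8) (A B : Fin 2) (μ ν ρ : Fin 6) : ℂ :=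
  d.pair (s A) ((d.Γ3 μ ν ρ).mulVec (s B))

/-- the Dirac current `κ^μ = ε_{AB} s̄^A Γ^μ s^B` -/
def kappa (s : Fin 2 → Spinor8) (μ : Fin 6) : ℂ :=
  ∑ A, ∑ B, epsS A B * d.pair (s A) ((d.ΓU μ).mulVec (s B))

end CliffordData

/-- Hodge star on 3-forms (components, indices down):
`(⋆T)_{μνρ} = (1/3!) ε_{μνρ}{}^{στυ} T_{στυ}`. -/
def hodge3C (T : Fin 6 → Fin 6 → Fin 6 → ℂ) (μ ν ρ : Fin 6) : ℂ :=
  (1 / 6 : ℂ) * ∑ σ, ∑ τ, ∑ υ,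
    (eps6 μ ν ρ σ τ υ : ℂ) * (ηd σ : ℂ) * (ηd τ : ℂ) * (ηd υ : ℂ) * T σ τ υ

/-- (components of) an alternating 3-tensor -/
def Alt3 (T : Fin 6 → Fin 6 → Fin 6 → ℂ) : Prop :=
  ∀ μ ν ρ, T ν μ ρ = - T μ ν ρ ∧ T μ ρ ν = - T μ ν ρ

/-- self-dual 3-form, `⋆T = T` -/
def SelfDual3 (T : Fin 6 → Fin 6 → Fin 6 → ℂ) : Prop :=
  ∀ μ ν ρ, hodge3C T μ ν ρ = T μ ν ρ

/-- antiself-dual 3-form, `⋆T = -T` -/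
def AntiSelfDual3 (T : Fin 6 → Fin 6 → Fin 6 → ℂ) : Prop :=
  ∀ μ ν ρ, hodge3C T μ ν ρ = - T μ ν ρ

/-- The Clifford action `½ ω_{ρσ} Γ^{ρσ}` of a 2-form `ω` on Σ. -/
def cliffAct2 (d : CliffordData) (ω : Fin 6 → Fin 6 → ℂ) :
    Matrix (Fin 8) (Fin 8) ℂ :=
  (1 / 2 : ℂ) • ∑ ρ, ∑ σ, (ω ρ σ * (ηd ρ : ℂ) * (ηd σ : ℂ)) • d.Γ2 ρ σ

/-- A cochain `β ∈ Hom(V ⊗ S, S)`, represented (after complexification) by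
matrices `βm μ A B`, applied to `s ∈ S`: `(β_μ s)^A = ∑_B βm μ A B (s^B)`. -/
def betaApp (βm : Fin 6 → Fin 2 → Fin 2 → Matrix (Fin 8) (Fin 8) ℂ)
    (μ : Fin 6) (s : Fin 2 → Spinor8) (A : Fin 2) : Spinor8 :=
  ∑ B, (βm μ A B).mulVec (s B)

/-- The (polarised) Dirac current with lowered index,
`κ(s,t)_μ = ½ ε_{AB} (s̄^A Γ_μ t^B + t̄^A Γ_μ s^B)`, so that `[s,s] = κ(s,s)`
in the Poincaré superalgebra. -/
def kappaLow (d : CliffordData) (s t : Fin 2 → Spinor8) (μ : Fin 6) : ℂ :=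
  (1 / 2 : ℂ) * ∑ A, ∑ B, epsS A B *
    (d.pair (s A) ((d.Γ μ).mulVec (t B)) + d.pair (t A) ((d.Γ μ).mulVec (s B)))

/-- A `Δ`-endomorphism-valued object `X_μ{}^A{}_B` with values in `⊙²Δ`,
i.e. traceless (equivalently, symmetric after lowering an index with ε). -/
def TracelessΔ (X : Fin 6 → Fin 2 → Fin 2 → ℂ) : Prop := ∀ μ, ∑ A, X μ A A = 0

/-- The sign in `Γ_μ Γ_ν = ± Γ_ν Γ_μ`. -/
def commSign (μ ν : Fin 6) : ℤ := if μ = ν then 1 else -1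

/-- `A (X Y) = (c c') (X Y) A` when `A` commutes with `X` and `Y` up to the scalars `c`, `c'`. -/
lemma scaled_comm_mul {A X Y : Matrix (Fin 8) (Fin 8) ℂ} {c c' : ℤ}
    (hX : A * X = c • (X * A)) (hY : A * Y = c' • (Y * A)) :
    A * (X * Y) = (c * c') • (X * Y * A) := by
  rw [← mul_assoc, hX, smul_mul_assoc, mul_assoc, hY, mul_smul_comm, smul_smul, mul_assoc]

lemma scaled_comm_sq {A X : Matrix (Fin 8) (Fin 8) ℂ} {c x a : ℤ}
    (h : A * X = c • (X * A)) (hX : X * X = x • 1) (hA : A * A = a • 1) :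
    (X * A) * (X * A) = (c * x * a) • (1 : Matrix (Fin 8) (Fin 8) ℂ) := by
  have : (X * A) * (X * A) = X * (A * X) * A := by noncomm_ring
  rw [this, h, mul_smul_comm, smul_mul_assoc,
    show X * (X * A) * A = (X * X) * (A * A) by noncomm_ring, hX, hA]
  simp [mul_comm, mul_left_comm]

lemma ηd_mul_self (μ : Fin 6) : (ηd μ : ℂ) * (ηd μ : ℂ) = 1 := by
  unfold ηd; split_ifs <;> norm_num

lemma ηd_ne_zero (μ : Fin 6) : (ηd μ : ℂ) ≠ 0 := fun h => by
  simpa [h] using ηd_mul_self μ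

namespace CliffordData

variable (d : CliffordData)

lemma Γ_sq (μ : Fin 6) : d.Γ μ * d.Γ μ = (ηd μ : ℂ) • 1 := by
  have h := d.clifford μ μ
  rw [if_pos rfl, ← two_smul ℂ, mul_smul] at h
  exact smul_right_injective _ (two_ne_zero (α := ℂ)) h

lemma Γ_anticomm {μ ν : Fin 6} (h : μ ≠ ν) : d.Γ μ * d.Γ ν = -(d.Γ ν * d.Γ μ) := by
  have := d.clifford μ ν
  rw [if_neg h, zero_smul] at this
  exact eq_neg_of_add_eq_zero_left this

lemma Γ_comm (μ ν : Fin 6) : d.Γ μ * d.Γ ν = commSign μ ν • (d.Γ ν * d.Γ μ) := by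
  by_cases h : μ = ν
  · simp [h, commSign]
  · simp [h, commSign, d.Γ_anticomm h]

lemma Γ_mul_Γ7 (μ : Fin 6) : d.Γ μ * d.Γ7 = -(d.Γ7 * d.Γ μ) := by
  have h := scaled_comm_mul (scaled_comm_mul (scaled_comm_mul (scaled_comm_mul (scaled_comm_mul
    (d.Γ_comm μ 0) (d.Γ_comm μ 1)) (d.Γ_comm μ 2)) (d.Γ_comm μ 3)) (d.Γ_comm μ 4)) (d.Γ_comm μ 5)
  rw [show commSign μ 0 * commSign μ 1 * commSign μ 2 * commSign μ 3 * commSign μ 4 *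
    commSign μ 5 = -1 by clear h; revert μ; decide, neg_one_smul] at h
  exact h

lemma Γ7_sq : d.Γ7 * d.Γ7 = 1 := by
  have sq : ∀ μ, d.Γ μ * d.Γ μ = (if μ = 0 then -1 else 1 : ℤ) • 1 := fun μ => by
    rw [d.Γ_sq, ηd]; split_ifs <;> simp
  have c (μ ν) := d.Γ_comm μ ν
  have h := scaled_comm_sq (scaled_comm_mul (scaled_comm_mul (scaled_comm_mul (scaled_comm_mul
    (c 5 0) (c 5 1)) (c 5 2)) (c 5 3)) (c 5 4)) (scaled_comm_sq (scaled_comm_mul (scaled_comm_mul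
    (scaled_comm_mul (c 4 0) (c 4 1)) (c 4 2)) (c 4 3)) (scaled_comm_sq (scaled_comm_mul
    (scaled_comm_mul (c 3 0) (c 3 1)) (c 3 2)) (scaled_comm_sq (scaled_comm_mul (c 2 0) (c 2 1))
    (scaled_comm_sq (c 1 0) (sq 0) (sq 1)) (sq 2)) (sq 3)) (sq 4)) (sq 5)
  simpa [commSign, Γ7] using h

/-- The projector `½(1 + Γ₇)` onto `Σ₊`. -/
def P : Matrix (Fin 8) (Fin 8) ℂ := (1 / 2 : ℂ) • (1 + d.Γ7)

lemma Γ7_mul_P : d.Γ7 * d.P = d.P := by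
  rw [P, mul_smul_comm, mul_add, d.Γ7_sq, mul_one, add_comm]

lemma P_mul_P : d.P * d.P = d.P := by
  nth_rewrite 1 [P]
  rw [smul_mul_assoc, add_mul, d.Γ7_mul_P, one_mul, ← two_smul ℂ, smul_smul]
  norm_num

lemma Γ_mul_P (μ : Fin 6) : d.Γ μ * d.P = (1 - d.P) * d.Γ μ := by
  rw [P, mul_smul_comm, mul_add, d.Γ_mul_Γ7, sub_mul, smul_mul_assoc, add_mul, mul_one, one_mul]
  module

lemma P_mul_Γ (μ : Fin 6) : d.P * d.Γ μ = d.Γ μ * (1 - d.P) := by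
  have := d.Γ_mul_P μ
  rw [sub_mul, one_mul] at this
  rw [mul_sub, mul_one, this]; abel

lemma P_mul_Γ_mul_P (μ : Fin 6) : d.P * d.Γ μ * d.P = 0 := by
  rw [d.P_mul_Γ, mul_assoc, sub_mul, one_mul, d.P_mul_P, sub_self, mul_zero]

lemma P_comm_ΓΓ (μ ν : Fin 6) : d.P * (d.Γ μ * d.Γ ν) = d.Γ μ * d.Γ ν * d.P := by
  rw [← mul_assoc, d.P_mul_Γ, mul_assoc, ← d.Γ_mul_P, mul_assoc]

lemma pos_iff {s : Spinor8} : d.Pos s ↔ d.P *ᵥ s = s := by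
  rw [Pos, P, smul_mulVec, add_mulVec, one_mulVec]
  constructor
  · intro h; rw [h, ← two_smul ℂ, smul_smul]; norm_num
  · intro h
    have h2 := congrArg ((2 : ℂ) • ·) h
    simp only [smul_smul] at h2
    norm_num [two_smul] at h2
    exact h2

lemma pos_P (x : Spinor8) : d.Pos (d.P *ᵥ x) := by
  rw [pos_iff, mulVec_mulVec, d.P_mul_P]

/-- Indices of a basis of the Clifford algebra: `((a, b), q, p)` stands for
`Γ_a Γ_b Γ₇^q Γ₀^p`, where `(0, 0)` represents the unit up to sign. -/
abbrev BasisIdx := {k : Fin 6 × Fin 6 // k.1 < k.2 ∨ k = (0, 0)} × Bool × Bool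

/-- The basis `Γ_a Γ_b Γ₇^q Γ₀^p` of the matrix algebra. -/
def basisElt (i : BasisIdx) : Matrix (Fin 8) (Fin 8) ℂ :=
  d.Γ i.1.1.1 * d.Γ i.1.1.2 * (if i.2.1 then d.Γ7 else 1) * (if i.2.2 then d.Γ 0 else 1)

/-- The sign picked up by conjugating a basis element with `Γ_μ`. -/
def basisSign (i : BasisIdx) (μ : Fin 6) : ℤ :=
  commSign μ i.1.1.1 * commSign μ i.1.1.2 * (if i.2.1 then -1 else 1) *
    (if i.2.2 then commSign μ 0 else 1)

lemma Γ_mul_basisElt (i : BasisIdx) (μ : Fin 6) :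
    d.Γ μ * d.basisElt i = basisSign i μ • (d.basisElt i * d.Γ μ) := by
  refine scaled_comm_mul (scaled_comm_mul (scaled_comm_mul (d.Γ_comm _ _) (d.Γ_comm _ _)) ?_) ?_
  · split_ifs <;> simp [d.Γ_mul_Γ7]
  · split_ifs <;> simp [← d.Γ_comm]

lemma isUnit_Γ (μ : Fin 6) : IsUnit (d.Γ μ) :=
  IsUnit.of_mul_eq_one ((ηd μ : ℂ) • d.Γ μ) (by
    rw [mul_smul_comm, d.Γ_sq, smul_smul, ηd_mul_self, one_smul])

lemma basisElt_ne_zero (i : BasisIdx) : d.basisElt i ≠ 0 := by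
  have h7 : IsUnit d.Γ7 := IsUnit.of_mul_eq_one _ d.Γ7_sq
  have : IsUnit (d.basisElt i) := by
    refine (((d.isUnit_Γ _).mul (d.isUnit_Γ _)).mul ?_).mul ?_ <;>
      split_ifs <;> first | exact isUnit_one | exact h7 | exact d.isUnit_Γ 0
  exact this.ne_zero

/-- `∑ 2^μ Γ_μ M Γ_μ⁻¹`, an operator diagonal in the basis `basisElt` with distinct eigenvalues. -/
def weightedConj : Module.End ℂ (Matrix (Fin 8) (Fin 8) ℂ) :=
  ∑ μ : Fin 6, ((2 : ℂ) ^ (μ : ℕ) * ηd μ) •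
    (LinearMap.mulLeft ℂ (d.Γ μ) ∘ₗ LinearMap.mulRight ℂ (d.Γ μ))

/-- The eigenvalue of `weightedConj` on a basis element. -/
def basisWeight (i : BasisIdx) : ℤ := ∑ μ : Fin 6, 2 ^ (μ : ℕ) * basisSign i μ

lemma weightedConj_basisElt (i : BasisIdx) :
    d.weightedConj (d.basisElt i) = (basisWeight i : ℂ) • d.basisElt i := by
  simp only [weightedConj, LinearMap.sum_apply, LinearMap.smul_apply, LinearMap.comp_apply,
    LinearMap.mulLeft_apply, LinearMap.mulRight_apply, basisWeight, Int.cast_sum, Finset.sum_smul]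
  refine Finset.sum_congr rfl fun μ _ => ?_
  rw [← mul_assoc, d.Γ_mul_basisElt, smul_mul_assoc, mul_assoc, d.Γ_sq, mul_smul_comm, mul_one,
    ← Int.cast_smul_eq_zsmul ℂ, smul_smul, smul_smul]
  congr 1
  push_cast
  linear_combination (2 ^ (μ : ℕ) * (basisSign i μ : ℂ)) * ηd_mul_self μ

lemma basisWeight_injective : Function.Injective basisWeight := by
  decide +kernel

lemma card_basisIdx : Fintype.card BasisIdx = 64 := by
  decide +kernel

lemma span_basisElt : Submodule.span ℂ (Set.range d.basisElt) = ⊤ := by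
  have hli : LinearIndependent ℂ d.basisElt :=
    Module.End.eigenvectors_linearIndependent' d.weightedConj (fun i => (basisWeight i : ℂ))
      (Int.cast_injective.comp basisWeight_injective) _
      fun i => ⟨Module.End.mem_eigenspace_iff.2 (d.weightedConj_basisElt i), d.basisElt_ne_zero i⟩
  refine hli.span_eq_top_of_card_eq_finrank' ?_
  rw [card_basisIdx, Module.finrank_matrix]
  simp

end CliffordData

/-- Components of the metric. -/
def etaC (ρ σ : Fin 6) : ℂ := if ρ = σ then (ηd ρ : ℂ) else 0

lemma etaC_comm (ρ σ : Fin 6) : etaC ρ σ = etaC σ ρ := by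
  by_cases h : ρ = σ
  · rw [h]
  · simp [etaC, h, Ne.symm h]

namespace CliffordData

variable (d : CliffordData)

lemma Γ_swap (ρ σ : Fin 6) : d.Γ ρ * d.Γ σ = (2 * etaC ρ σ) • 1 - d.Γ σ * d.Γ ρ := by
  rw [eq_sub_iff_add_eq, d.clifford]
  simp [etaC]

lemma trace_eq_zero_of_anticomm {μ : Fin 6} {Y : Matrix (Fin 8) (Fin 8) ℂ}
    (h : d.Γ μ * Y = -(Y * d.Γ μ)) : Y.trace = 0 := by
  have h1 : (d.Γ μ * Y * d.Γ μ).trace = -(ηd μ * Y.trace) := by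
    rw [h, neg_mul, mul_assoc, d.Γ_sq, mul_smul_comm, mul_one, trace_neg, trace_smul, smul_eq_mul]
  have h2 : (d.Γ μ * Y * d.Γ μ).trace = ηd μ * Y.trace := by
    rw [trace_mul_comm, ← mul_assoc, d.Γ_sq, smul_mul_assoc, one_mul, trace_smul, smul_eq_mul]
  have h3 : (ηd μ : ℂ) * Y.trace = 0 := by linear_combination (h1 - h2) / 2
  exact (mul_eq_zero.1 h3).resolve_left (ηd_ne_zero μ)

lemma trace_ΓΓ (ρ σ : Fin 6) : (d.Γ ρ * d.Γ σ).trace = 8 * etaC ρ σ := by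
  have h := congrArg trace (d.Γ_swap ρ σ)
  rw [trace_sub, trace_smul, trace_one, trace_mul_comm (d.Γ σ)] at h
  simp at h
  linear_combination h / 2

lemma trace_ΓΓΓΓ (σ ρ a b : Fin 6) : (d.Γ σ * d.Γ ρ * (d.Γ a * d.Γ b)).trace =
    8 * (etaC σ ρ * etaC a b - etaC σ a * etaC ρ b + etaC σ b * etaC ρ a) := by
  have e : d.Γ σ * d.Γ ρ * (d.Γ a * d.Γ b) = (2 * etaC σ ρ) • (d.Γ a * d.Γ b)
      - (2 * etaC σ a) • (d.Γ ρ * d.Γ b) + (2 * etaC σ b) • (d.Γ ρ * d.Γ a)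
      - d.Γ ρ * d.Γ a * d.Γ b * d.Γ σ := by
    have h1 : d.Γ σ * d.Γ ρ * (d.Γ a * d.Γ b) = (2 * etaC σ ρ) • (d.Γ a * d.Γ b)
        - d.Γ ρ * (d.Γ σ * d.Γ a) * d.Γ b := by
      rw [d.Γ_swap σ ρ, sub_mul, smul_mul_assoc, one_mul]; noncomm_ring
    have h2 : d.Γ ρ * (d.Γ σ * d.Γ a) * d.Γ b = (2 * etaC σ a) • (d.Γ ρ * d.Γ b)
        - d.Γ ρ * d.Γ a * (d.Γ σ * d.Γ b) := by
      rw [d.Γ_swap σ a, mul_sub, sub_mul, mul_smul_comm, smul_mul_assoc, mul_one]; noncomm_ring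
    have h3 : d.Γ ρ * d.Γ a * (d.Γ σ * d.Γ b) = (2 * etaC σ b) • (d.Γ ρ * d.Γ a)
        - d.Γ ρ * d.Γ a * d.Γ b * d.Γ σ := by
      rw [d.Γ_swap σ b, mul_sub, mul_smul_comm, mul_one]; noncomm_ring
    rw [h1, h2, h3]; abel
  have h := congrArg trace e
  rw [trace_sub, trace_add, trace_sub, trace_smul, trace_smul, trace_smul, trace_ΓΓ, trace_ΓΓ,
    trace_ΓΓ, trace_mul_comm _ (d.Γ σ),
    show d.Γ σ * (d.Γ ρ * d.Γ a * d.Γ b) = d.Γ σ * d.Γ ρ * (d.Γ a * d.Γ b) by noncomm_ring] at h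
  simp only [smul_eq_mul] at h
  linear_combination h / 2

lemma trace_ΓΓΓΓ_Γ7 (σ ρ a b : Fin 6) :
    (d.Γ σ * d.Γ ρ * (d.Γ a * d.Γ b) * d.Γ7).trace = 0 := by
  obtain ⟨μ, h1, h2, h3, h4⟩ : ∃ μ : Fin 6, μ ≠ σ ∧ μ ≠ ρ ∧ μ ≠ a ∧ μ ≠ b := by
    revert σ ρ a b; decide
  refine d.trace_eq_zero_of_anticomm (μ := μ) ?_
  have h := scaled_comm_mul (scaled_comm_mul (scaled_comm_mul (d.Γ_comm μ σ) (d.Γ_comm μ ρ))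
    (scaled_comm_mul (d.Γ_comm μ a) (d.Γ_comm μ b)))
    (show d.Γ μ * d.Γ7 = (-1 : ℤ) • (d.Γ7 * d.Γ μ) by rw [d.Γ_mul_Γ7, neg_one_smul])
  simpa [commSign, h1, h2, h3, h4] using h

lemma trace_ΓΓΓΓ_P (σ ρ a b : Fin 6) : (d.Γ σ * d.Γ ρ * (d.Γ a * d.Γ b * d.P)).trace =
    4 * (etaC σ ρ * etaC a b - etaC σ a * etaC ρ b + etaC σ b * etaC ρ a) := by
  rw [← mul_assoc, P, mul_smul_comm, mul_add, mul_one, trace_smul, trace_add, trace_ΓΓΓΓ,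
    trace_ΓΓΓΓ_Γ7, smul_eq_mul]
  ring

lemma trace_ΓΓ_P (a b : Fin 6) : (d.Γ a * d.Γ b * d.P).trace = 4 * etaC a b := by
  have h := d.trace_ΓΓΓΓ_P 0 0 a b
  rw [d.Γ_sq, smul_mul_assoc, one_mul, trace_smul, smul_eq_mul] at h
  have e0 : etaC 0 0 = ηd 0 := by simp [etaC]
  have e : etaC 0 a * etaC 0 b = etaC 0 b * etaC 0 a := mul_comm _ _
  rw [e0] at h
  refine mul_left_cancel₀ (ηd_ne_zero 0) ?_
  linear_combination h - 4 * e

lemma sum_etaC_left (τ : Fin 6) (f : Fin 6 → Matrix (Fin 8) (Fin 8) ℂ) :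
    ∑ ρ, ((ηd ρ : ℂ) * etaC ρ τ) • f ρ = f τ := by
  rw [Finset.sum_eq_single τ (fun ρ _ h => by simp [etaC, h]) (by simp)]
  simp [etaC, ηd_mul_self]

lemma expansion_ΓΓ_P (a b : Fin 6) :
    (8 : ℂ) • (d.Γ a * d.Γ b * d.P) =
      ∑ ρ, ∑ σ, ((ηd ρ : ℂ) * ηd σ * (d.Γ σ * d.Γ ρ * (d.Γ a * d.Γ b * d.P)).trace) •
        (d.Γ ρ * d.Γ σ * d.P) - (4 * (d.Γ a * d.Γ b * d.P).trace) • d.P := by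
  have key : ∑ ρ, ∑ σ, ((ηd ρ : ℂ) * ηd σ * (d.Γ σ * d.Γ ρ * (d.Γ a * d.Γ b * d.P)).trace) •
        (d.Γ ρ * d.Γ σ * d.P) = (24 * etaC a b) • d.P - (4 : ℂ) • (d.Γ b * d.Γ a * d.P)
        + (4 : ℂ) • (d.Γ a * d.Γ b * d.P) := by
    have e (ρ σ : Fin 6) :
        ((ηd ρ : ℂ) * ηd σ * (d.Γ σ * d.Γ ρ * (d.Γ a * d.Γ b * d.P)).trace) •
        (d.Γ ρ * d.Γ σ * d.P) =
        (4 * etaC a b) • ((ηd σ * etaC σ ρ) • (ηd ρ : ℂ) • (d.Γ ρ * d.Γ σ * d.P))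
        - (4 : ℂ) • (((ηd σ : ℂ) * etaC σ a) • (((ηd ρ : ℂ) * etaC ρ b) • (d.Γ ρ * d.Γ σ * d.P)))
        + (4 : ℂ) • (((ηd σ : ℂ) * etaC σ b) •
          (((ηd ρ : ℂ) * etaC ρ a) • (d.Γ ρ * d.Γ σ * d.P))) := by
      rw [trace_ΓΓΓΓ_P]; module
    simp only [e, Finset.sum_add_distrib, Finset.sum_sub_distrib, ← Finset.smul_sum,
      sum_etaC_left]
    simp only [d.Γ_sq, smul_mul_assoc, one_mul, smul_smul, ηd_mul_self, Finset.sum_const,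
      Finset.card_univ, Fintype.card_fin]
    module
  rw [key, trace_ΓΓ_P, d.Γ_swap b a, sub_mul, smul_mul_assoc, one_mul,
    show etaC b a = etaC a b from etaC_comm b a]
  module

lemma P_basisElt_P (i : BasisIdx) : d.P * d.basisElt i * d.P =
    if i.2.2 then 0 else d.Γ i.1.1.1 * d.Γ i.1.1.2 * d.P := by
  have h7 : d.P * d.Γ7 = d.P := by
    rw [P, smul_mul_assoc, add_mul, d.Γ7_sq, one_mul, add_comm]
  obtain ⟨⟨⟨a, b⟩, hk⟩, q, p⟩ := i
  have hX : d.P * (d.Γ a * d.Γ b * (if q then d.Γ7 else 1)) = d.Γ a * d.Γ b * d.P := by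
    rw [← mul_assoc, d.P_comm_ΓΓ, mul_assoc]
    split_ifs <;> simp [h7]
  rw [basisElt, ← mul_assoc, hX]
  cases p
  · simp [mul_assoc, d.P_mul_P]
  · have := d.P_mul_Γ_mul_P 0
    simp [mul_assoc] at this
    simp [mul_assoc, this]

/-- Completeness of `1, Γ_{ρσ}` in `End Σ₊`. -/
lemma expansion (M : Matrix (Fin 8) (Fin 8) ℂ) :
    (8 : ℂ) • (d.P * M * d.P) =
      ∑ ρ, ∑ σ, ((ηd ρ : ℂ) * ηd σ * (d.Γ σ * d.Γ ρ * (d.P * M * d.P)).trace) •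
        (d.Γ ρ * d.Γ σ * d.P) - (4 * (d.P * M * d.P).trace) • d.P := by
  have hM : M ∈ Submodule.span ℂ (Set.range d.basisElt) := by
    rw [span_basisElt]; trivial
  induction hM using Submodule.span_induction with
  | mem x hx =>
    obtain ⟨i, rfl⟩ := hx
    rw [P_basisElt_P]
    split_ifs
    · simp
    · exact d.expansion_ΓΓ_P _ _
  | zero => simp
  | add x y _ _ hx hy =>
    simp only [mul_add, add_mul, trace_add, add_smul, smul_add, Finset.sum_add_distrib, hx, hy]
    abel
  | smul c x _ hx =>
    have h := congrArg (c • ·) hx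
    simp only [mul_smul_comm, smul_mul_assoc, trace_smul] at h ⊢
    rw [smul_comm, h, smul_sub, Finset.smul_sum]
    simp only [Finset.smul_sum, smul_smul, smul_eq_mul]


lemma conjS_add (s t : Spinor8) : d.conjS (s + t) = d.conjS s + d.conjS t := by
  rw [conjS, conjS, conjS, ← mulVec_add]
  congr 1; funext a; simp

lemma conjS_smul (c : ℂ) (s : Spinor8) : d.conjS (c • s) = starRingEnd ℂ c • d.conjS s := by
  rw [conjS, conjS, ← mulVec_smul]
  congr 1; funext a; simp

lemma conjS_conjS (s : Spinor8) : d.conjS (d.conjS s) = -s := by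
  have h : (fun a => starRingEnd ℂ ((d.J *ᵥ fun a => starRingEnd ℂ (s a)) a)) =
      d.J.map (starRingEnd ℂ) *ᵥ s := by
    funext a; simp [mulVec, dotProduct]
  rw [conjS, conjS, h, mulVec_mulVec, d.J_sq, neg_mulVec, one_mulVec]

lemma conjS_Γ_mulVec (μ : Fin 6) (s : Spinor8) :
    d.conjS (d.Γ μ *ᵥ s) = d.Γ μ *ᵥ d.conjS s := by
  have h : (fun a => starRingEnd ℂ ((d.Γ μ *ᵥ s) a)) =
      (d.Γ μ).map (starRingEnd ℂ) *ᵥ fun a => starRingEnd ℂ (s a) := by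
    funext a; simp [mulVec, dotProduct]
  rw [conjS, conjS, h, mulVec_mulVec, d.J_conj, mulVec_mulVec]

lemma Pos.conjS {s : Spinor8} (h : d.Pos s) : d.Pos (d.conjS s) := by
  have e : d.conjS (d.Γ7 *ᵥ s) = d.Γ7 *ᵥ d.conjS s := by
    simp only [Γ7, ← mulVec_mulVec, conjS_Γ_mulVec]
  unfold Pos at h ⊢
  rw [← e, h]

lemma Pos.add {s t : Spinor8} (hs : d.Pos s) (ht : d.Pos t) : d.Pos (s + t) := by
  unfold Pos at *; rw [mulVec_add, hs, ht]

lemma Pos.smul {s : Spinor8} (c : ℂ) (hs : d.Pos s) : d.Pos (c • s) := by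
  unfold Pos at *; rw [mulVec_smul, hs]

lemma IsS.add {s t : Fin 2 → Spinor8} (hs : d.IsS s) (ht : d.IsS t) : d.IsS (s + t) := by
  refine ⟨fun A => (hs.1 A).add d (ht.1 A), ?_, ?_⟩
  · simp [conjS_add, hs.2.1, ht.2.1]
  · simp [conjS_add, hs.2.2, ht.2.2, add_comm]

/-- `S` is a real form of `Σ₊ ⊗ Δ`. -/
lemma exists_isS_add_I_smul {s : Fin 2 → Spinor8} (hs : ∀ A, d.Pos (s A)) :
    ∃ u v, d.IsS u ∧ d.IsS v ∧ s = u + Complex.I • v := by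
  have hI : starRingEnd ℂ (Complex.I / 2) = -(Complex.I / 2) := by
    simp [neg_div, Complex.conj_ofNat]
  have h2 : starRingEnd ℂ (1 / 2) = (1 / 2 : ℂ) := by simp [Complex.conj_ofNat]
  refine ⟨![(1 / 2 : ℂ) • s 0 + (-1 / 2 : ℂ) • d.conjS (s 1),
      (1 / 2 : ℂ) • s 1 + (1 / 2 : ℂ) • d.conjS (s 0)],
    ![(-(Complex.I / 2)) • s 0 + (-(Complex.I / 2)) • d.conjS (s 1),
      (-(Complex.I / 2)) • s 1 + (Complex.I / 2) • d.conjS (s 0)], ⟨?_, ?_, ?_⟩, ⟨?_, ?_, ?_⟩, ?_⟩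
  · rw [Fin.forall_fin_two]
    exact ⟨((hs 0).smul d _).add d (((hs 1).conjS d).smul d _),
      ((hs 1).smul d _).add d (((hs 0).conjS d).smul d _)⟩
  · simp only [cons_val_zero, cons_val_one, conjS_add, conjS_smul, conjS_conjS, h2, neg_div, map_neg]
    module
  · simp only [cons_val_zero, cons_val_one, conjS_add, conjS_smul, conjS_conjS, h2]
    module
  · rw [Fin.forall_fin_two]
    exact ⟨((hs 0).smul d _).add d (((hs 1).conjS d).smul d _),
      ((hs 1).smul d _).add d (((hs 0).conjS d).smul d _)⟩
  · simp only [cons_val_zero, cons_val_one, conjS_add, conjS_smul, conjS_conjS, hI, map_neg]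
    module
  · simp only [cons_val_zero, cons_val_one, conjS_add, conjS_smul, conjS_conjS, hI, map_neg]
    module
  · have e : Complex.I * (Complex.I / 2) = -1 / 2 := by
      linear_combination Complex.I_mul_I / 2
    funext A
    fin_cases A
    · simp only [Fin.zero_eta, Pi.add_apply, Pi.smul_apply, cons_val_zero, smul_add, smul_smul,
        mul_neg, e]
      module
    · simp only [Fin.mk_one, Pi.add_apply, Pi.smul_apply, cons_val_one, cons_val_zero, smul_add,
        smul_smul, mul_neg, e]
      module

end CliffordData

/-- The bilinear form on `Σ ⊗ Δ` with blocks `K A C`. -/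
def blockForm (K : Fin 2 → Fin 2 → Matrix (Fin 8) (Fin 8) ℂ) :
    (Fin 2 → Spinor8) →ₗ[ℂ] (Fin 2 → Spinor8) →ₗ[ℂ] ℂ :=
  LinearMap.mk₂ ℂ (fun s t => ∑ A, ∑ C, s A ⬝ᵥ K A C *ᵥ t C)
    (by intros; simp [add_dotProduct, Finset.sum_add_distrib])
    (by intros; simp; ring)
    (by intros; simp [mulVec_add, dotProduct_add, Finset.sum_add_distrib])
    (by intros; simp [mulVec_smul]; ring)

lemma blockForm_apply (K : Fin 2 → Fin 2 → Matrix (Fin 8) (Fin 8) ℂ) (s t : Fin 2 → Spinor8) :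
    blockForm K s t = ∑ A, ∑ C, s A ⬝ᵥ K A C *ᵥ t C := rfl

lemma blockForm_single (K : Fin 2 → Fin 2 → Matrix (Fin 8) (Fin 8) ℂ) (A C : Fin 2)
    (x y : Spinor8) : blockForm K (Pi.single A x) (Pi.single C y) = x ⬝ᵥ K A C *ᵥ y := by
  rw [blockForm_apply, Finset.sum_eq_single A (fun B _ h => by simp [h]) (by simp),
    Finset.sum_eq_single C (fun B _ h => by simp [h]) (by simp)]
  simp

namespace CliffordData

variable (d : CliffordData)

lemma pos_single {x : Spinor8} (hx : d.Pos x) (A B : Fin 2) :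
    d.Pos ((Pi.single A x : Fin 2 → Spinor8) B) := by
  by_cases h : B = A
  · subst h; simpa using hx
  · simp [h, Pos]

lemma blockForm_eq_zero {K : Fin 2 → Fin 2 → Matrix (Fin 8) (Fin 8) ℂ}
    (h : ∀ s, d.IsS s → blockForm K s s = 0) {s : Fin 2 → Spinor8} (hs : ∀ A, d.Pos (s A)) :
    blockForm K s s = 0 := by
  obtain ⟨u, v, hu, hv, rfl⟩ := d.exists_isS_add_I_smul hs
  have huv := h _ (hu.add d hv)
  simp only [map_add, map_smul, LinearMap.add_apply, LinearMap.smul_apply, smul_eq_mul, h u hu,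
    h v hv] at huv ⊢
  linear_combination Complex.I * huv

/-- A quadratic form vanishing on `S` has vanishing polarisation on `Σ₊ ⊗ Δ`. -/
lemma block_add_transpose_eq_zero {K : Fin 2 → Fin 2 → Matrix (Fin 8) (Fin 8) ℂ}
    (h : ∀ s, d.IsS s → blockForm K s s = 0) (A C : Fin 2) :
    d.Pᵀ * K A C * d.P + (d.Pᵀ * K C A * d.P)ᵀ = 0 := by
  have key (x y : Spinor8) :
      (d.P *ᵥ x) ⬝ᵥ K A C *ᵥ (d.P *ᵥ y) + (d.P *ᵥ y) ⬝ᵥ K C A *ᵥ (d.P *ᵥ x) = 0 := by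
    have hx := d.pos_single (d.pos_P x) A
    have hy := d.pos_single (d.pos_P y) C
    have hxy := d.blockForm_eq_zero h (fun B => (hx B).add d (hy B))
    have hxy' : blockForm K (Pi.single A (d.P *ᵥ x) + Pi.single C (d.P *ᵥ y))
      (Pi.single A (d.P *ᵥ x) + Pi.single C (d.P *ᵥ y)) = 0 := hxy
    rw [map_add (blockForm K), LinearMap.add_apply, map_add, map_add, d.blockForm_eq_zero h hx,
      d.blockForm_eq_zero h hy, blockForm_single, blockForm_single, zero_add, add_zero] at hxy'
    exact hxy'
  have conv (M : Matrix (Fin 8) (Fin 8) ℂ) (x y : Spinor8) :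
      (d.P *ᵥ x) ⬝ᵥ M *ᵥ (d.P *ᵥ y) = x ⬝ᵥ (d.Pᵀ * M * d.P) *ᵥ y := by
    rw [← mulVec_mulVec, ← mulVec_mulVec, dotProduct_mulVec x, vecMul_transpose]
  ext i j
  have := key (Pi.single i 1) (Pi.single j 1)
  rw [conv, conv] at this
  rw [Matrix.add_apply, transpose_apply]
  simpa using this


lemma Γ7_transpose_mul_B : d.Γ7ᵀ * d.B = -(d.B * d.Γ7) := by
  have h1 : (1 + d.Γ7)ᵀ * d.B * (1 + d.Γ7) = 0 := d.B_iso_pos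
  have h2 : (1 - d.Γ7)ᵀ * d.B * (1 - d.Γ7) = 0 := d.B_iso_neg
  rw [transpose_add, transpose_one] at h1
  rw [transpose_sub, transpose_one] at h2
  have h3 : (2 : ℂ) • (d.B + d.Γ7ᵀ * d.B * d.Γ7) = 0 := by
    have e : (1 + d.Γ7ᵀ) * d.B * (1 + d.Γ7) + (1 - d.Γ7ᵀ) * d.B * (1 - d.Γ7) =
        (2 : ℂ) • (d.B + d.Γ7ᵀ * d.B * d.Γ7) := by
      simp only [add_mul, sub_mul, mul_add, mul_sub, one_mul, mul_one]; module
    rw [← e, h1, h2, add_zero]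
  have h4 := (smul_eq_zero.1 h3).resolve_left two_ne_zero
  have h5 := congrArg (· * d.Γ7) h4
  simp only [add_mul, mul_assoc, d.Γ7_sq, mul_one, zero_mul] at h5
  exact eq_neg_of_add_eq_zero_right h5

lemma P_transpose_mul_B : d.Pᵀ * d.B = d.B * (1 - d.P) := by
  rw [P, transpose_smul, transpose_add, transpose_one, smul_mul_assoc, add_mul,
    d.Γ7_transpose_mul_B, one_mul, mul_sub, mul_smul_comm, mul_add, mul_one]
  module

lemma P_transpose_mul_BΓ (μ : Fin 6) (M : Matrix (Fin 8) (Fin 8) ℂ) :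
    d.Pᵀ * (d.B * d.Γ μ * M) * d.P = d.B * (d.Γ μ * (d.P * M * d.P)) := by
  have : d.Pᵀ * (d.B * d.Γ μ * M) * d.P = (d.Pᵀ * d.B) * d.Γ μ * (M * d.P) := by noncomm_ring
  rw [this, d.P_transpose_mul_B, mul_assoc d.B, ← d.Γ_mul_P]
  noncomm_ring

lemma trace_add_smul_trace {Y W W' : Matrix (Fin 8) (Fin 8) ℂ} {c : ℂ}
    (hY : Yᵀ * d.B = c • (d.B * Y)) (h : d.B * W + (d.B * W')ᵀ = 0) :
    (Y * W).trace + c * (Y * W').trace = 0 := by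
  have hB : IsUnit d.B.det := (isUnit_iff_isUnit_det _).1 d.B_nondeg
  rw [transpose_mul, d.B_symm] at h
  have hW : W = -(d.B⁻¹ * W'ᵀ * d.B) := by
    have := congrArg (d.B⁻¹ * ·) h
    simp only [mul_add, ← mul_assoc, nonsing_inv_mul _ hB, one_mul, mul_zero] at this
    exact eq_neg_of_add_eq_zero_left this
  have hadj : d.B⁻¹ * Yᵀ * d.B = c • Y := by
    rw [mul_assoc, hY, mul_smul_comm, ← mul_assoc, nonsing_inv_mul _ hB, one_mul]
  have ht : (Y * (d.B⁻¹ * W'ᵀ * d.B)).trace = c * (Y * W').trace := by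
    rw [← trace_transpose]
    simp only [transpose_mul, transpose_transpose, transpose_nonsing_inv, d.B_symm]
    rw [show d.B * (W' * d.B⁻¹) * Yᵀ = d.B * (W' * d.B⁻¹ * Yᵀ) by noncomm_ring, trace_mul_comm,
      show W' * d.B⁻¹ * Yᵀ * d.B = W' * (d.B⁻¹ * Yᵀ * d.B) by noncomm_ring, hadj, mul_smul_comm,
      trace_smul, trace_mul_comm, smul_eq_mul]
  rw [hW, mul_neg, trace_neg, ht, neg_add_cancel]

lemma Γ_transpose_mul_B (μ : Fin 6) : (d.Γ μ)ᵀ * d.B = (-1 : ℂ) • (d.B * d.Γ μ) := by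
  rw [d.B_skew, neg_one_smul]

lemma ΓΓΓ_reverse {τ ρ σ : Fin 6} (h1 : τ ≠ ρ) (h2 : τ ≠ σ) (h3 : ρ ≠ σ) :
    d.Γ σ * d.Γ ρ * d.Γ τ = -(d.Γ τ * d.Γ ρ * d.Γ σ) := by
  rw [mul_assoc, d.Γ_anticomm h1.symm, mul_neg, ← mul_assoc, d.Γ_anticomm h2.symm, neg_mul,
    neg_neg, mul_assoc, d.Γ_anticomm h3.symm, mul_neg, mul_assoc]

lemma ΓΓΓ_transpose_mul_B_reverse (τ ρ σ : Fin 6) :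
    (d.Γ τ * d.Γ ρ * d.Γ σ)ᵀ * d.B = -(d.B * (d.Γ σ * d.Γ ρ * d.Γ τ)) := by
  rw [transpose_mul, transpose_mul, mul_assoc, mul_assoc, d.B_skew, mul_neg, ← mul_assoc _ d.B,
    d.B_skew, neg_mul, neg_neg, ← mul_assoc, ← mul_assoc, d.B_skew]
  noncomm_ring

lemma ΓΓΓ_transpose_mul_B {τ ρ σ : Fin 6} (h1 : τ ≠ ρ) (h2 : τ ≠ σ) (h3 : ρ ≠ σ) :
    (d.Γ τ * d.Γ ρ * d.Γ σ)ᵀ * d.B = (1 : ℂ) • (d.B * (d.Γ τ * d.Γ ρ * d.Γ σ)) := by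
  rw [ΓΓΓ_transpose_mul_B_reverse, d.ΓΓΓ_reverse h1 h2 h3, mul_neg, neg_neg, one_smul]

lemma Γ3_transpose_mul_B (μ ν ρ : Fin 6) :
    (d.Γ3 μ ν ρ)ᵀ * d.B = (1 : ℂ) • (d.B * d.Γ3 μ ν ρ) := by
  simp only [Γ3, transpose_smul, transpose_add, transpose_sub, smul_mul_assoc, add_mul, sub_mul,
    ΓΓΓ_transpose_mul_B_reverse, mul_smul_comm, mul_add, mul_sub]
  module

lemma Γ_mul_Γ2 (μ ρ σ : Fin 6) : d.Γ μ * d.Γ2 ρ σ =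
    d.Γ3 μ ρ σ + etaC μ ρ • d.Γ σ - etaC μ σ • d.Γ ρ := by
  have swap_right (a b c : Fin 6) :
      d.Γ a * d.Γ b * d.Γ c = (2 * etaC b c) • d.Γ a - d.Γ a * d.Γ c * d.Γ b := by
    rw [mul_assoc, d.Γ_swap b c, mul_sub, mul_smul_comm, mul_one, mul_assoc]
  have swap_left (a b c : Fin 6) :
      d.Γ a * d.Γ b * d.Γ c = (2 * etaC a b) • d.Γ c - d.Γ b * d.Γ a * d.Γ c := by
    rw [d.Γ_swap a b, sub_mul, smul_mul_assoc, one_mul]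
  rw [Γ2, Γ3, mul_smul_comm, mul_sub, ← mul_assoc, ← mul_assoc, swap_left σ ρ μ,
    swap_right ρ σ μ, swap_left ρ μ σ, swap_left σ μ ρ, swap_right μ σ ρ, etaC_comm ρ μ,
    etaC_comm σ μ]
  module

lemma pair_mulVec_comm {X : Matrix (Fin 8) (Fin 8) ℂ} {c : ℂ} (hX : Xᵀ * d.B = c • (d.B * X))
    (s t : Spinor8) : d.pair s (X *ᵥ t) = c * d.pair t (X *ᵥ s) := by
  rw [pair, pair, mulVec_mulVec, mulVec_mulVec, dotProduct_mulVec, dotProduct_comm,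
    ← mulVec_transpose, transpose_mul, d.B_symm, hX, smul_mulVec, dotProduct_smul, smul_eq_mul]

lemma kappaLow_eq (s t : Fin 2 → Spinor8) (μ : Fin 6) :
    kappaLow d s t μ = d.pair (s 0) (d.Γ μ *ᵥ t 1) - d.pair (s 1) (d.Γ μ *ᵥ t 0) := by
  have h (A B) := d.pair_mulVec_comm (d.Γ_transpose_mul_B μ) (t A) (s B)
  simp only [kappaLow, epsS, Fin.sum_univ_two, h]
  norm_num
  ring

/-- The operators `½(1 + Γ₇) β_ν{}^A{}_B ½(1 + Γ₇)` on `Σ₊`. -/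
def proj (βm : Fin 6 → Fin 2 → Fin 2 → Matrix (Fin 8) (Fin 8) ℂ) (ν : Fin 6) (A C : Fin 2) :
    Matrix (Fin 8) (Fin 8) ℂ := d.P * βm ν A C * d.P

/-- Blocks of the quadratic form `κ(s, β_ν s)_μ + κ(s, β_μ s)_ν`. -/
def cocycleBlock (βm : Fin 6 → Fin 2 → Fin 2 → Matrix (Fin 8) (Fin 8) ℂ) (μ ν : Fin 6) :
    Fin 2 → Fin 2 → Matrix (Fin 8) (Fin 8) ℂ :=
  ![fun C => d.B * d.Γ μ * βm ν 1 C + d.B * d.Γ ν * βm μ 1 C,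
    fun C => -(d.B * d.Γ μ * βm ν 0 C + d.B * d.Γ ν * βm μ 0 C)]

lemma blockForm_cocycleBlock (βm : Fin 6 → Fin 2 → Fin 2 → Matrix (Fin 8) (Fin 8) ℂ)
    (μ ν : Fin 6) (s : Fin 2 → Spinor8) :
    blockForm (d.cocycleBlock βm μ ν) s s =
      kappaLow d s (betaApp βm ν s) μ + kappaLow d s (betaApp βm μ s) ν := by
  simp only [kappaLow_eq, blockForm_apply, cocycleBlock, Fin.sum_univ_two, cons_val_zero,
    cons_val_one, betaApp, pair, mulVec_add, add_mulVec, neg_mulVec, dotProduct_add,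
    dotProduct_neg, ← mulVec_mulVec]
  ring

lemma P_cocycleBlock_P (βm : Fin 6 → Fin 2 → Fin 2 → Matrix (Fin 8) (Fin 8) ℂ)
    (μ ν : Fin 6) (A C : Fin 2) :
    d.Pᵀ * d.cocycleBlock βm μ ν A C * d.P =
      d.B * ![fun C => d.Γ μ * d.proj βm ν 1 C + d.Γ ν * d.proj βm μ 1 C,
        fun C => -(d.Γ μ * d.proj βm ν 0 C + d.Γ ν * d.proj βm μ 0 C)] A C := by
  fin_cases A
  · simp [cocycleBlock, proj, mul_add, add_mul, P_transpose_mul_BΓ]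
  · simp [cocycleBlock, proj, mul_add, add_mul, P_transpose_mul_BΓ]

/-- The `Δ`-trace of `β`. -/
def traceΔ (βm : Fin 6 → Fin 2 → Fin 2 → Matrix (Fin 8) (Fin 8) ℂ) (ν : Fin 6) :
    Matrix (Fin 8) (Fin 8) ℂ := βm ν 0 0 + βm ν 1 1

/-- The `Δ`-traceless part of `β`. -/
def tracefreeΔ (βm : Fin 6 → Fin 2 → Fin 2 → Matrix (Fin 8) (Fin 8) ℂ) (A C : Fin 2) (ν : Fin 6) :
    Matrix (Fin 8) (Fin 8) ℂ :=
  βm ν A C - if A = C then (1 / 2 : ℂ) • traceΔ βm ν else 0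

section TraceEquations

variable {βm : Fin 6 → Fin 2 → Fin 2 → Matrix (Fin 8) (Fin 8) ℂ}

lemma block_trace {Y : Matrix (Fin 8) (Fin 8) ℂ} {c : ℂ} (h : ∀ s, d.IsS s → ∀ μ ν,
      kappaLow d s (betaApp βm ν s) μ + kappaLow d s (betaApp βm μ s) ν = 0)
    (hY : Yᵀ * d.B = c • (d.B * Y)) (μ ν : Fin 6) (A C : Fin 2) :
    (Y * ![fun C => d.Γ μ * d.proj βm ν 1 C + d.Γ ν * d.proj βm μ 1 C,
        fun C => -(d.Γ μ * d.proj βm ν 0 C + d.Γ ν * d.proj βm μ 0 C)] A C).trace +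
    c * (Y * ![fun C => d.Γ μ * d.proj βm ν 1 C + d.Γ ν * d.proj βm μ 1 C,
        fun C => -(d.Γ μ * d.proj βm ν 0 C + d.Γ ν * d.proj βm μ 0 C)] C A).trace = 0 := by
  have hK := d.block_add_transpose_eq_zero (K := d.cocycleBlock βm μ ν)
    (fun s hs => by rw [blockForm_cocycleBlock]; exact h s hs μ ν) A C
  rw [P_cocycleBlock_P, P_cocycleBlock_P] at hK
  exact d.trace_add_smul_trace hY hK

lemma trace_traceΔ (h : ∀ s, d.IsS s → ∀ μ ν,
      kappaLow d s (betaApp βm ν s) μ + kappaLow d s (betaApp βm μ s) ν = 0) (μ ν τ : Fin 6) :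
    (d.Γ τ * d.Γ μ * (d.P * traceΔ βm ν * d.P)).trace +
      (d.Γ τ * d.Γ ν * (d.P * traceΔ βm μ * d.P)).trace = 0 := by
  have h01 := d.block_trace h (d.Γ_transpose_mul_B τ) μ ν 0 1
  simp only [cons_val_zero, cons_val_one, proj, mul_add, mul_neg, trace_add, trace_neg,
    ← mul_assoc] at h01
  simp only [traceΔ, mul_add, add_mul, trace_add, ← mul_assoc]
  linear_combination h01

lemma trace_tracefreeΔ (h : ∀ s, d.IsS s → ∀ μ ν,
      kappaLow d s (betaApp βm ν s) μ + kappaLow d s (betaApp βm μ s) ν = 0) (A C : Fin 2)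
    (μ ν : Fin 6) {τ ρ σ : Fin 6} (h1 : τ ≠ ρ) (h2 : τ ≠ σ) (h3 : ρ ≠ σ) :
    (d.Γ τ * d.Γ ρ * d.Γ σ * (d.Γ μ * (d.P * tracefreeΔ βm A C ν * d.P))).trace +
      (d.Γ τ * d.Γ ρ * d.Γ σ * (d.Γ ν * (d.P * tracefreeΔ βm A C μ * d.P))).trace = 0 := by
  have hY := d.block_trace h (d.ΓΓΓ_transpose_mul_B h1 h2 h3) μ ν
  have h01 := hY 0 1
  have h00 := hY 0 0
  have h11 := hY 1 1
  simp only [cons_val_zero, cons_val_one, proj, mul_add, mul_neg, trace_add, trace_neg,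
    ← mul_assoc] at h01 h00 h11
  fin_cases A <;> fin_cases C <;>
    simp [tracefreeΔ, traceΔ, mul_add, mul_sub, add_mul, sub_mul, trace_add, trace_sub,
      ← mul_assoc]
  · linear_combination -h01 / 2
  · linear_combination -h11 / 2
  · linear_combination h00 / 2
  · linear_combination h01 / 2

end TraceEquations

lemma Γ2_of_ne {ρ σ : Fin 6} (h : ρ ≠ σ) : d.Γ2 ρ σ = d.Γ ρ * d.Γ σ := by
  rw [Γ2, ← neg_eq_iff_eq_neg.2 (d.Γ_anticomm h), sub_neg_eq_add, ← two_smul ℂ, smul_smul]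
  norm_num

lemma expansion_traceΔ {T : Fin 6 → Matrix (Fin 8) (Fin 8) ℂ}
    (hT : ∀ μ ν τ, (d.Γ τ * d.Γ μ * (d.P * T ν * d.P)).trace +
      (d.Γ τ * d.Γ ν * (d.P * T μ * d.P)).trace = 0) :
    Alt3 (fun μ ρ σ => (d.Γ σ * d.Γ ρ * (d.P * T μ * d.P)).trace / 8) ∧
    ∀ μ, (1 / 2 : ℂ) • (d.P * T μ * d.P) =
      cliffAct2 d (fun ρ σ => (d.Γ σ * d.Γ ρ * (d.P * T μ * d.P)).trace / 8) * d.P := by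
  have h0 (μ) : (d.P * T μ * d.P).trace = 0 := by
    have := hT μ μ μ
    rw [d.Γ_sq, smul_mul_assoc, one_mul, trace_smul, smul_eq_mul] at this
    linear_combination (ηd μ : ℂ) / 2 * this - (d.P * T μ * d.P).trace * ηd_mul_self μ
  have hskew (μ ρ σ) : (d.Γ ρ * d.Γ σ * (d.P * T μ * d.P)).trace =
      -(d.Γ σ * d.Γ ρ * (d.P * T μ * d.P)).trace := by
    rw [d.Γ_swap ρ σ, sub_mul, smul_mul_assoc, one_mul, trace_sub, trace_smul, h0, smul_zero,
      zero_sub]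
  refine ⟨fun μ ν ρ => ⟨?_, ?_⟩, fun μ => ?_⟩
  · linear_combination hT ν μ ρ / 8
  · linear_combination hskew μ ν ρ / 8
  · have hx := d.expansion (T μ)
    rw [h0, mul_zero, zero_smul, sub_zero] at hx
    have h16 : (1 / 2 : ℂ) • (d.P * T μ * d.P) = (1 / 16 : ℂ) • (8 : ℂ) • (d.P * T μ * d.P) := by
      module
    rw [h16, hx, cliffAct2, smul_mul_assoc, Finset.sum_mul, Finset.smul_sum, Finset.smul_sum]
    refine Finset.sum_congr rfl fun ρ _ => ?_
    rw [Finset.sum_mul, Finset.smul_sum, Finset.smul_sum]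
    refine Finset.sum_congr rfl fun σ _ => ?_
    by_cases hρσ : ρ = σ
    · subst hρσ
      have : (d.Γ ρ * d.Γ ρ * (d.P * T μ * d.P)).trace = 0 := by
        linear_combination hskew μ ρ ρ / 2
      simp [this]
    · rw [d.Γ2_of_ne hρσ]
      simp only [smul_mul_assoc, smul_smul]
      congr 1; ring

lemma expansion_tracefreeΔ {R : Fin 6 → Matrix (Fin 8) (Fin 8) ℂ}
    (hR : ∀ μ ν τ ρ σ, τ ≠ ρ → τ ≠ σ → ρ ≠ σ →
      (d.Γ τ * d.Γ ρ * d.Γ σ * (d.Γ μ * (d.P * R ν * d.P))).trace +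
      (d.Γ τ * d.Γ ρ * d.Γ σ * (d.Γ ν * (d.P * R μ * d.P))).trace = 0) (μ : Fin 6) :
    d.P * R μ * d.P = ((d.P * R μ * d.P).trace / 4) • d.P + ∑ σ, ((ηd σ : ℂ) *
      (ηd (σ + 1) * (d.Γ σ * d.Γ (σ + 1) * (d.P * R (σ + 1) * d.P)).trace / 4)) •
        (d.Γ2 μ σ * d.P) := by
  have hcancel (τ ρ σ : Fin 6) (N : Matrix (Fin 8) (Fin 8) ℂ) :
      (d.Γ τ * d.Γ ρ * d.Γ σ * (d.Γ σ * N)).trace = ηd σ * (d.Γ τ * d.Γ ρ * N).trace := by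
    rw [show d.Γ τ * d.Γ ρ * d.Γ σ * (d.Γ σ * N) = d.Γ τ * d.Γ ρ * (d.Γ σ * d.Γ σ) * N by
      noncomm_ring, d.Γ_sq, mul_smul_comm, mul_one, smul_mul_assoc, trace_smul, smul_eq_mul]
  have hoff (μ τ ρ : Fin 6) (h1 : τ ≠ ρ) (h2 : τ ≠ μ) (h3 : ρ ≠ μ) :
      (d.Γ τ * d.Γ ρ * (d.P * R μ * d.P)).trace = 0 := by
    have := hR μ μ τ ρ μ h1 h2 h3
    rw [hcancel] at this
    linear_combination (ηd μ : ℂ) / 2 * this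
      - (d.Γ τ * d.Γ ρ * (d.P * R μ * d.P)).trace * ηd_mul_self μ
  have hdiag (μ ν τ : Fin 6) (h1 : τ ≠ ν) (h2 : τ ≠ μ) :
      ηd ν * (d.Γ τ * d.Γ ν * (d.P * R ν * d.P)).trace =
        ηd μ * (d.Γ τ * d.Γ μ * (d.P * R μ * d.P)).trace := by
    by_cases h3 : ν = μ
    · rw [h3]
    have := hR μ ν τ ν μ h1 h2 h3
    rw [hcancel, show d.Γ τ * d.Γ ν * d.Γ μ * (d.Γ ν * (d.P * R μ * d.P)) =
      d.Γ τ * (d.Γ ν * d.Γ μ) * (d.Γ ν * (d.P * R μ * d.P)) by noncomm_ring,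
      d.Γ_anticomm h3, mul_neg, neg_mul, ← mul_assoc (d.Γ τ), trace_neg, hcancel] at this
    linear_combination (ηd μ * ηd ν : ℂ) * this
      - ηd ν * (d.Γ τ * d.Γ ν * (d.P * R ν * d.P)).trace * ηd_mul_self μ
      + ηd μ * (d.Γ τ * d.Γ μ * (d.P * R μ * d.P)).trace * ηd_mul_self ν
  set φ : Fin 6 → ℂ := fun σ =>
    ηd (σ + 1) * (d.Γ σ * d.Γ (σ + 1) * (d.P * R (σ + 1) * d.P)).trace / 4 with hφ
  have hφμ (σ) (h : σ ≠ μ) : (d.Γ σ * d.Γ μ * (d.P * R μ * d.P)).trace = 4 * ηd μ * φ σ := by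
    have := hdiag μ (σ + 1) σ (by clear * -; revert σ; decide) h
    simp only [hφ, this]
    linear_combination -(d.Γ σ * d.Γ μ * (d.P * R μ * d.P)).trace * ηd_mul_self μ
  have hx := d.expansion (R μ)
  have hoffμ := hoff μ
  generalize d.P * R μ * d.P = N at hx hφμ hoffμ ⊢
  have hterm (ρ σ : Fin 6) :
      ((ηd ρ : ℂ) * ηd σ * (d.Γ σ * d.Γ ρ * N).trace) • (d.Γ ρ * d.Γ σ * d.P) =
      (if ρ = σ then N.trace • d.P else 0)
      + (if ρ = μ then (4 * ((ηd σ : ℂ) * φ σ)) • (d.Γ2 μ σ * d.P) else 0)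
      + (if σ = μ then (4 * ((ηd ρ : ℂ) * φ ρ)) • (d.Γ2 μ ρ * d.P) else 0) := by
    by_cases hρσ : ρ = σ
    · subst hρσ
      have : ((ηd ρ : ℂ) * ηd ρ * (d.Γ ρ * d.Γ ρ * N).trace) • (d.Γ ρ * d.Γ ρ * d.P) =
          N.trace • d.P := by
        rw [d.Γ_sq, smul_mul_assoc, smul_mul_assoc, one_mul, one_mul, trace_smul, smul_eq_mul,
          smul_smul]
        congr 1
        linear_combination N.trace * (ηd ρ * ηd ρ + 1 : ℂ) * ηd_mul_self ρ
      rw [this, if_pos rfl]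
      split_ifs with hρ
      · simp [hρ, Γ2]
      · simp
    rw [if_neg hρσ, zero_add]
    by_cases hρ : ρ = μ
    · subst hρ
      rw [if_pos rfl, if_neg (Ne.symm hρσ), add_zero, hφμ σ (Ne.symm hρσ), d.Γ2_of_ne hρσ]
      congr 1
      linear_combination (4 * ηd σ * φ σ : ℂ) * ηd_mul_self ρ
    rw [if_neg hρ, zero_add]
    by_cases hσ : σ = μ
    · subst hσ
      rw [if_pos rfl, d.Γ_anticomm (Ne.symm hρσ), neg_mul, trace_neg, hφμ ρ hρσ,
        d.Γ2_of_ne (Ne.symm hρσ), d.Γ_anticomm hρσ, neg_mul, smul_neg, ← neg_smul]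
      congr 1
      linear_combination (4 * ηd ρ * φ ρ : ℂ) * ηd_mul_self σ
    · rw [if_neg hσ, hoffμ σ ρ (Ne.symm hρσ) hσ hρ, mul_zero, zero_smul]
  simp only [hterm, Finset.sum_add_distrib, Finset.sum_ite_eq, Finset.sum_ite_eq', Finset.mem_univ,
    if_true, Finset.sum_const, Finset.card_univ, Fintype.card_fin] at hx
  rw [Finset.sum_comm] at hx
  simp only [Finset.sum_ite_eq', Finset.mem_univ, if_true, mul_smul (4 : ℂ),
    ← Finset.smul_sum] at hx
  refine smul_right_injective _ (show (8 : ℂ) ≠ 0 by norm_num) ?_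
  simp only [hx]
  module


lemma pair_add (s t t' : Spinor8) : d.pair s (t + t') = d.pair s t + d.pair s t' := by
  simp [pair, mulVec_add]

lemma pair_smul (c : ℂ) (s t : Spinor8) : d.pair s (c • t) = c * d.pair s t := by
  simp [pair, mulVec_smul]

lemma pair_sum {ι : Type*} (I : Finset ι) (s : Spinor8) (f : ι → Spinor8) :
    d.pair s (∑ i ∈ I, f i) = ∑ i ∈ I, d.pair s (f i) := by
  classical
  induction I using Finset.induction_on with
  | empty => simp [pair]
  | insert a I ha ih => rw [Finset.sum_insert ha, Finset.sum_insert ha, pair_add, ih]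

lemma pair_Γ_swap (s t : Spinor8) (μ : Fin 6) :
    d.pair s (d.Γ μ *ᵥ t) = -d.pair t (d.Γ μ *ᵥ s) := by
  rw [d.pair_mulVec_comm (d.Γ_transpose_mul_B μ), neg_one_mul]

lemma pair_Γ_self (s : Spinor8) (μ : Fin 6) : d.pair s (d.Γ μ *ᵥ s) = 0 := by
  linear_combination d.pair_Γ_swap s s μ / 2

lemma pair_Γ_Γ2 (s t : Spinor8) (μ ρ σ : Fin 6) :
    d.pair s (d.Γ μ *ᵥ (d.Γ2 ρ σ *ᵥ t)) = d.pair s (d.Γ3 μ ρ σ *ᵥ t)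
      + etaC μ ρ * d.pair s (d.Γ σ *ᵥ t) - etaC μ σ * d.pair s (d.Γ ρ *ᵥ t) := by
  rw [mulVec_mulVec, d.Γ_mul_Γ2, sub_eq_add_neg, ← neg_smul, add_mulVec, add_mulVec, pair_add,
    pair_add, smul_mulVec, smul_mulVec, pair_smul, pair_smul]
  ring

lemma kappa_eq (s : Fin 2 → Spinor8) (ρ : Fin 6) :
    d.kappa s ρ = 2 * (ηd ρ * d.pair (s 0) (d.Γ ρ *ᵥ s 1)) := by
  simp only [kappa, epsS, Fin.sum_univ_two, ΓU, smul_mulVec, pair_smul,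
    d.pair_Γ_swap (s 1) (s 0)]
  norm_num
  ring

lemma kappaLow_add (s t t' : Fin 2 → Spinor8) (μ : Fin 6) :
    kappaLow d s (t + t') μ = kappaLow d s t μ + kappaLow d s t' μ := by
  simp only [kappaLow_eq, Pi.add_apply, mulVec_add, pair_add]
  ring

lemma kappaLow_Δ_smul {X : Fin 2 → Fin 2 → ℂ} (hX : ∑ A, X A A = 0) (s : Fin 2 → Spinor8)
    (μ : Fin 6) : kappaLow d s (fun A => ∑ B, X A B • s B) μ = 0 := by
  rw [Fin.sum_univ_two] at hX
  simp only [kappaLow_eq, Fin.sum_univ_two, mulVec_add, mulVec_smul, pair_add, pair_smul,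
    pair_Γ_self, d.pair_Γ_swap (s 1) (s 0)]
  linear_combination d.pair (s 0) (d.Γ μ *ᵥ s 1) * hX

lemma kappaLow_cliffAct2 {H : Fin 6 → Fin 6 → ℂ} (hH : ∀ ρ σ, H ρ σ = -H σ ρ)
    (s : Fin 2 → Spinor8) (μ : Fin 6) :
    kappaLow d s (fun A => cliffAct2 d H *ᵥ s A) μ = ∑ σ, d.kappa s σ * H μ σ := by
  have hterm (ρ σ : Fin 6) : d.pair (s 0) (d.Γ μ *ᵥ (d.Γ2 ρ σ *ᵥ s 1))
      - d.pair (s 1) (d.Γ μ *ᵥ (d.Γ2 ρ σ *ᵥ s 0)) =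
      2 * (etaC μ ρ * d.pair (s 0) (d.Γ σ *ᵥ s 1) - etaC μ σ * d.pair (s 0) (d.Γ ρ *ᵥ s 1)) := by
    rw [pair_Γ_Γ2, pair_Γ_Γ2, d.pair_Γ_swap (s 1) (s 0), d.pair_Γ_swap (s 1) (s 0),
      d.pair_mulVec_comm (d.Γ3_transpose_mul_B μ ρ σ) (s 1) (s 0)]
    ring
  have hsum (f : Fin 6 → ℂ) : ∑ ρ, (ηd ρ * etaC μ ρ) * f ρ = f μ := by
    rw [Finset.sum_eq_single μ (fun ρ _ h => by simp [etaC, Ne.symm h]) (by simp)]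
    simp [etaC, ηd_mul_self]
  have hexp (A C : Fin 2) : d.pair (s A) (d.Γ μ *ᵥ (cliffAct2 d H *ᵥ s C)) =
      1 / 2 * ∑ ρ, ∑ σ, H ρ σ * ηd ρ * ηd σ * d.pair (s A) (d.Γ μ *ᵥ (d.Γ2 ρ σ *ᵥ s C)) := by
    simp only [cliffAct2, smul_mulVec, sum_mulVec, mulVec_smul, mulVec_sum, pair_smul, pair_sum]
  rw [kappaLow_eq, hexp, hexp, ← mul_sub, ← Finset.sum_sub_distrib]
  simp only [← Finset.sum_sub_distrib, ← mul_sub, hterm]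
  have e (ρ σ : Fin 6) : H ρ σ * ηd ρ * ηd σ * (2 * (etaC μ ρ * d.pair (s 0) (d.Γ σ *ᵥ s 1)
      - etaC μ σ * d.pair (s 0) (d.Γ ρ *ᵥ s 1))) =
      (ηd ρ * etaC μ ρ) * (d.kappa s σ * H ρ σ) + (ηd σ * etaC μ σ) * (d.kappa s ρ * H σ ρ) := by
    rw [kappa_eq, kappa_eq, hH σ ρ]; ring
  simp only [e, Finset.sum_add_distrib, hsum]
  rw [Finset.sum_comm]
  simp only [hsum]
  ring

lemma kappaLow_Γ2 {φ : Fin 6 → Fin 2 → Fin 2 → ℂ} (hφ : TracelessΔ φ) (s : Fin 2 → Spinor8)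
    (μ ν : Fin 6) :
    kappaLow d s (fun A => ∑ B, ∑ ρ, ((ηd ρ : ℂ) * φ ρ A B) • (d.Γ2 ν ρ *ᵥ s B)) μ =
      ∑ ρ, ∑ A, ∑ B, (ηd ρ : ℂ) * (∑ C, epsS A C * φ ρ C B) * d.omega3 s A B μ ν ρ := by
  simp only [kappaLow_eq, Fin.sum_univ_two, Finset.sum_add_distrib, mulVec_add, pair_add, mulVec_sum,
    mulVec_smul, pair_sum, pair_smul]
  simp only [← Finset.sum_add_distrib, ← Finset.sum_sub_distrib]
  refine Finset.sum_congr rfl fun ρ _ => ?_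
  have h := hφ ρ
  rw [Fin.sum_univ_two] at h
  simp only [pair_Γ_Γ2, pair_Γ_self, d.pair_Γ_swap (s 1) (s 0), omega3, epsS]
  norm_num
  linear_combination (ηd ρ : ℂ) * (etaC μ ν * d.pair (s 0) (d.Γ ρ *ᵥ s 1)
    - etaC μ ρ * d.pair (s 0) (d.Γ ν *ᵥ s 1)) * h

/-- The bracket `κ(s, β_ν s)_μ` for `β` of the form determined by `C`, `H` and `φ`. -/
lemma kappaLow_of_form {Cm φm : Fin 6 → Fin 2 → Fin 2 → ℂ} {Ht : Fin 6 → Fin 6 → Fin 6 → ℂ}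
    (hC : TracelessΔ Cm) (hH : Alt3 Ht) (hφ : TracelessΔ φm) (s t : Fin 2 → Spinor8) (μ ν : Fin 6)
    (ht : ∀ A, t A = (∑ B, Cm ν A B • s B) + (cliffAct2 d (Ht ν)).mulVec (s A)
      + ∑ B, ∑ ρ, ((ηd ρ : ℂ) * φm ρ A B) • (d.Γ2 ν ρ).mulVec (s B)) :
    kappaLow d s t μ = -(∑ ρ, d.kappa s ρ * Ht ρ μ ν) +
      ∑ ρ, ∑ A, ∑ B, (ηd ρ : ℂ) * (∑ C, epsS A C * φm ρ C B) * d.omega3 s A B μ ν ρ := by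
  have e : t = (fun A => ∑ B, Cm ν A B • s B) + (fun A => cliffAct2 d (Ht ν) *ᵥ s A)
      + fun A => ∑ B, ∑ ρ, ((ηd ρ : ℂ) * φm ρ A B) • (d.Γ2 ν ρ *ᵥ s B) := funext ht
  rw [e, kappaLow_add, kappaLow_add, d.kappaLow_Δ_smul (hC ν),
    d.kappaLow_cliffAct2 (fun ρ σ => (hH ν σ ρ).2), d.kappaLow_Γ2 hφ, zero_add,
    ← Finset.sum_neg_distrib]
  congr 1
  refine Finset.sum_congr rfl fun σ _ => ?_
  rw [(hH ν σ μ).2, (hH σ ν μ).1, (hH σ μ ν).2]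
  ring

/-- The action of `β` on `S` only involves its compression to `Σ₊`. -/
lemma betaApp_eq_proj {βm : Fin 6 → Fin 2 → Fin 2 → Matrix (Fin 8) (Fin 8) ℂ} {μ : Fin 6}
    {s : Fin 2 → Spinor8} (hs : d.IsS s) (hβ : d.IsS (betaApp βm μ s)) (A : Fin 2) :
    betaApp βm μ s A = ∑ B, (d.P * tracefreeΔ βm A B μ * d.P) *ᵥ s B +
      ((1 / 2 : ℂ) • (d.P * traceΔ βm μ * d.P)) *ᵥ s A := by
  have hβA := d.pos_iff.1 (hβ.1 A)
  have hPs (B) := d.pos_iff.1 (hs.1 B)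
  rw [← hβA, betaApp, mulVec_sum]
  have e (B : Fin 2) : (d.P * tracefreeΔ βm A B μ * d.P) *ᵥ s B = d.P *ᵥ (βm μ A B *ᵥ s B) -
      if A = B then ((1 / 2 : ℂ) • (d.P * traceΔ βm μ * d.P)) *ᵥ s B else 0 := by
    rw [tracefreeΔ, mul_sub, sub_mul, sub_mulVec, ← mulVec_mulVec, ← mulVec_mulVec, hPs]
    split_ifs
    · rw [mul_smul_comm, smul_mul_assoc]
    · simp
  simp only [e, Finset.sum_sub_distrib, Finset.sum_ite_eq, Finset.mem_univ, if_true,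
    sub_add_cancel]

end CliffordData

/-- A normalised cochain
`β + γ ∈ Hom(V ⊗ S, S) ⊕ Hom(⊙²S, so(V))` of the Spencer complex of the d=6
(1,0) Poincaré superalgebra satisfies the first cocycle condition
`γ(s,s) v + 2 [s, β_v s] = 0` (for all `s ∈ S`, `v ∈ V`; in components
`γ(s,s)_{μν} + 2 ε_{AB} s̄^A Γ_μ (β_ν s)^B = 0`) if and only if it has the form
`(β_μ s)^A = C_μ{}^A{}_B s^B + ½ H_{μρσ} Γ^{ρσ} s^A + φ^{ρ A}{}_B Γ_{μρ} s^B`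
and `γ(s,s)_{μν} = 2 κ^ρ H_{ρμν} - 2 φ^ρ{}_{AB} ω_{μνρ}{}^{AB}` for some
`C ∈ V ⊗ ⊙²Δ`, `H ∈ Λ³V` and `φ ∈ V ⊗ ⊙²Δ`, where `κ` and `ω` are the Dirac
current and 3-form bilinears of `s`. -/
theorem first_cocycle_condition_solution (d : CliffordData)
    (βm : Fin 6 → Fin 2 → Fin 2 → Matrix (Fin 8) (Fin 8) ℂ)
    (γf : (Fin 2 → Spinor8) → Fin 6 → Fin 6 → ℂ)
    (hβS : ∀ s, d.IsS s → ∀ μ, d.IsS (betaApp βm μ s))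
    (hγskew : ∀ s, d.IsS s → ∀ μ ν, γf s ν μ = - γf s μ ν) :
    (∀ s, d.IsS s → ∀ μ ν,
        γf s μ ν + 2 * kappaLow d s (betaApp βm ν s) μ = 0)
    ↔ (∃ (Cm : Fin 6 → Fin 2 → Fin 2 → ℂ) (Ht : Fin 6 → Fin 6 → Fin 6 → ℂ)
         (φm : Fin 6 → Fin 2 → Fin 2 → ℂ),
         TracelessΔ Cm ∧ Alt3 Ht ∧ TracelessΔ φm ∧
         (∀ s, d.IsS s → ∀ μ A,
            betaApp βm μ s A =
              (∑ B, Cm μ A B • s B) + (cliffAct2 d (Ht μ)).mulVec (s A)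
                + ∑ B, ∑ ρ, ((ηd ρ : ℂ) * φm ρ A B) • (d.Γ2 μ ρ).mulVec (s B)) ∧
         (∀ s, d.IsS s → ∀ μ ν,
            γf s μ ν = 2 * ∑ ρ, d.kappa s ρ * Ht ρ μ ν
              - 2 * ∑ ρ, ∑ A, ∑ B,
                  (ηd ρ : ℂ) * (∑ C, epsS A C * φm ρ C B) * d.omega3 s A B μ ν ρ)) := by
  constructor
  · intro h
    have hsym (s) (hs : d.IsS s) (μ ν) :
        kappaLow d s (betaApp βm ν s) μ + kappaLow d s (betaApp βm μ s) ν = 0 := by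
      linear_combination (h s hs μ ν + h s hs ν μ - hγskew s hs μ ν) / 2
    obtain ⟨hAlt, hT⟩ := d.expansion_traceΔ (d.trace_traceΔ hsym)
    have hR (A B : Fin 2) := d.expansion_tracefreeΔ
      fun μ ν _ _ _ h1 h2 h3 => d.trace_tracefreeΔ hsym A B μ ν h1 h2 h3
    have hfree (μ) : CliffordData.tracefreeΔ βm 1 1 μ = -CliffordData.tracefreeΔ βm 0 0 μ := by
      simp only [CliffordData.tracefreeΔ, CliffordData.traceΔ, if_true]
      module
    have hC : TracelessΔ fun μ A B =>
        (d.P * CliffordData.tracefreeΔ βm A B μ * d.P).trace / 4 := fun μ => by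
      simp [Fin.sum_univ_two, hfree, neg_div]
    have hφ : TracelessΔ fun σ A B => (ηd (σ + 1) : ℂ) * (d.Γ σ * d.Γ (σ + 1) *
        (d.P * CliffordData.tracefreeΔ βm A B (σ + 1) * d.P)).trace / 4 := fun μ => by
      simp [Fin.sum_univ_two, hfree, neg_div]
    have hform (s) (hs : d.IsS s) (μ A) := d.betaApp_eq_proj hs (hβS s hs μ) A
    have hPs (s) (hs : d.IsS s) (A) := d.pos_iff.1 (hs.1 A)
    have hβ (s) (hs : d.IsS s) (μ A) : betaApp βm μ s A =
        (∑ B, ((d.P * CliffordData.tracefreeΔ βm A B μ * d.P).trace / 4) • s B) +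
        (cliffAct2 d fun ρ σ => (d.Γ σ * d.Γ ρ *
          (d.P * CliffordData.traceΔ βm μ * d.P)).trace / 8).mulVec (s A) +
        ∑ B, ∑ ρ, ((ηd ρ : ℂ) * ((ηd (ρ + 1) : ℂ) * (d.Γ ρ * d.Γ (ρ + 1) *
          (d.P * CliffordData.tracefreeΔ βm A B (ρ + 1) * d.P)).trace / 4)) •
            (d.Γ2 μ ρ).mulVec (s B) := by
      rw [hform s hs, hT, ← mulVec_mulVec, hPs s hs, add_right_comm, ← Finset.sum_add_distrib]
      congr 1
      refine Finset.sum_congr rfl fun B _ => ?_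
      conv_lhs => rw [hR A B μ]
      simp only [add_mulVec, sum_mulVec, smul_mulVec, ← mulVec_mulVec, hPs s hs]
    refine ⟨_, _, _, hC, hAlt, hφ, hβ, fun s hs μ ν => ?_⟩
    have hk := d.kappaLow_of_form hC hAlt hφ s _ μ ν (hβ s hs ν)
    linear_combination h s hs μ ν - 2 * hk
  · rintro ⟨Cm, Ht, φm, hC, hH, hφ, hβ, hγ⟩ s hs μ ν
    rw [hγ s hs, d.kappaLow_of_form hC hH hφ s _ μ ν (hβ s hs ν)]
    ring
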